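/- For every n ≥ 2 there exists a continuous compactly supported function f : ℝⁿ → ℝ such that the Poisson equation Δu = f has no solution of class C² on ℝⁿ: there is no twice continuously differentiable function u : ℝⁿ → ℝ with ∑ᵢ ∂ᵢ²u(x) = f(x) for all x ∈ ℝⁿ. -/

import Mathlib

open MeasureTheory

/-- Partial derivative `∂ᵢ u` of a function on `ℝⁿ = EuclideanSpace ℝ (Fin n)`. -/
noncomputable def pd {n : ℕ} (u : EuclideanSpace ℝ (Fin n) → ℝ) (i : Fin n)
    (x : EuclideanSpace ℝ (Fin n)) : ℝ :=
  fderiv ℝ u x (EuclideanSpace.single i 1)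

/-- Second partial derivative `∂ᵢ∂ⱼ u`. -/
noncomputable def pd2 {n : ℕ} (u : EuclideanSpace ℝ (Fin n) → ℝ) (i j : Fin n)
    (x : EuclideanSpace ℝ (Fin n)) : ℝ :=
  pd (pd u j) i x

/-- Laplacian `Δu = ∑ᵢ ∂ᵢ² u`. -/
noncomputable def lap {n : ℕ} (u : EuclideanSpace ℝ (Fin n) → ℝ)
    (x : EuclideanSpace ℝ (Fin n)) : ℝ :=
  ∑ i : Fin n, pd2 u i i x

/-- Euclidean norm of the gradient, `|∇u|(x) = (∑ᵢ (∂ᵢu)²)^{1/2}`. -/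
noncomputable def gradNorm {n : ℕ} (u : EuclideanSpace ℝ (Fin n) → ℝ)
    (x : EuclideanSpace ℝ (Fin n)) : ℝ :=
  Real.sqrt (∑ i : Fin n, pd u i x ^ 2)

/-- Hilbert–Schmidt norm of the Hessian, `|Hess u|(x) = (∑_{i,j} (∂ᵢ∂ⱼu)²)^{1/2}`. -/
noncomputable def hessNorm {n : ℕ} (u : EuclideanSpace ℝ (Fin n) → ℝ)
    (x : EuclideanSpace ℝ (Fin n)) : ℝ :=
  Real.sqrt (∑ i : Fin n, ∑ j : Fin n, pd2 u i j x ^ 2)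

/-- `L^p` norm with respect to Lebesgue measure on `ℝⁿ`:  `(∫ |f|^p)^{1/p}`. -/
noncomputable def lpNorm {n : ℕ} (p : ℝ) (f : EuclideanSpace ℝ (Fin n) → ℝ) : ℝ :=
  (∫ x, |f x| ^ p) ^ (1 / p)

open Set Filter Topology
open scoped ContDiff

theorem pd_contDiff {n : ℕ} {m : WithTop ℕ∞} {u : EuclideanSpace ℝ (Fin n) → ℝ}
    (hu : ContDiff ℝ (m + 1) u) (i : Fin n) : ContDiff ℝ m (pd u i) := by
  unfold pd
  exact (hu.fderiv_right le_rfl).clm_apply contDiff_const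

theorem pd_hcs {n : ℕ} {u : EuclideanSpace ℝ (Fin n) → ℝ}
    (hu : HasCompactSupport u) (i : Fin n) : HasCompactSupport (pd u i) := by
  unfold pd
  exact hu.fderiv_apply ℝ _

theorem pd_ibp {n : ℕ} {a b : EuclideanSpace ℝ (Fin n) → ℝ} (ha : ContDiff ℝ 1 a)
    (hb : ContDiff ℝ 1 b) (hc : HasCompactSupport b) (i : Fin n) :
    ∫ x, a x * pd b i x = - ∫ x, pd a i x * b x := by
  have h1 : Continuous (pd a i) := (pd_contDiff (m := 0) (by simpa using ha) i).continuous
  have h2 : Continuous (pd b i) := (pd_contDiff (m := 0) (by simpa using hb) i).continuous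
  exact integral_mul_fderiv_eq_neg_fderiv_mul_of_integrable
    ((h1.mul hb.continuous).integrable_of_hasCompactSupport hc.mul_left)
    ((ha.continuous.mul h2).integrable_of_hasCompactSupport (pd_hcs hc i).mul_left)
    ((ha.continuous.mul hb.continuous).integrable_of_hasCompactSupport hc.mul_left)
    (fun x _ => ha.differentiable (by simp) x) (fun x _ => hb.differentiable (by simp) x)

theorem pd2_eq {n : ℕ} {u : EuclideanSpace ℝ (Fin n) → ℝ} (hu : ContDiff ℝ 2 u) (i j : Fin n)
    (x : EuclideanSpace ℝ (Fin n)) :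
    pd2 u i j x = fderiv ℝ (fderiv ℝ u) x (EuclideanSpace.single i 1) (EuclideanSpace.single j 1) := by
  have h : DifferentiableAt ℝ (fderiv ℝ u) x :=
    (hu.fderiv_right (m := 1) (by norm_num)).differentiable (by simp) x
  unfold pd2 pd
  rw [fderiv_clm_apply h (by fun_prop)]
  simp

theorem pd2_comm {n : ℕ} {u : EuclideanSpace ℝ (Fin n) → ℝ} (hu : ContDiff ℝ 2 u) (i j : Fin n) :
    pd2 u i j = pd2 u j i := by
  ext x
  rw [pd2_eq hu, pd2_eq hu]
  exact (hu.contDiffAt.isSymmSndFDerivAt (by simp)) _ _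

theorem pd2_pd_comm {n : ℕ} {u : EuclideanSpace ℝ (Fin n) → ℝ} (hu : ContDiff ℝ 2 u) (i j : Fin n) :
    pd (pd u i) j = pd (pd u j) i := pd2_comm hu j i

theorem pd2_ibp {n : ℕ} {u p : EuclideanSpace ℝ (Fin n) → ℝ} (hu : ContDiff ℝ 2 u)
    (hp : ContDiff ℝ 3 p) (hc : HasCompactSupport p) (i j l : Fin n) :
    ∫ x, pd2 u l l x * pd2 p i j x = ∫ x, pd2 u i j x * pd2 p l l x := by
  have hu1 : ∀ i, ContDiff ℝ 1 (pd u i) := fun i => pd_contDiff (by simpa [one_add_one_eq_two] using hu) i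
  have hp2 : ContDiff ℝ 2 p := hp.of_le (by norm_num)
  have hp1 : ∀ i, ContDiff ℝ 2 (pd p i) := fun i => pd_contDiff (by convert hp using 1; norm_num) i
  have hpp : ∀ i j, ContDiff ℝ 1 (pd (pd p i) j) := fun i j =>
    pd_contDiff (by simpa [one_add_one_eq_two] using hp1 i) j
  have hcc : ∀ i j, HasCompactSupport (pd (pd p i) j) := fun i j => pd_hcs (pd_hcs hc i) j
  unfold pd2
  have e1 := pd_ibp (hu1 l) (hpp j i) (hcc j i) l
  have e2 := pd_ibp (hu1 l) (hpp j l) (hcc j l) i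
  have e3 := pd_ibp (hu1 i) (hpp l j) (hcc l j) l
  have e4 := pd_ibp (hu1 i) (hpp l l) (hcc l l) j
  have c1 : pd (pd (pd p j) i) l = pd (pd (pd p j) l) i := pd2_pd_comm (hp1 j) i l
  have c2 : pd (pd u i) l = pd (pd u l) i := pd2_pd_comm hu i l
  have c3 : pd (pd (pd p l) j) l = pd (pd (pd p l) l) j := pd2_pd_comm (hp1 l) j l
  have c4 : pd (pd p j) l = pd (pd p l) j := pd2_pd_comm hp2 j l
  have c5 : pd (pd u i) j = pd (pd u j) i := pd2_pd_comm hu i j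
  rw [c1] at e1
  rw [c4] at e2
  rw [c2, c3] at e3
  rw [c5] at e4
  rw [c4] at e1
  linarith

theorem lap_ibp {n : ℕ} {u p : EuclideanSpace ℝ (Fin n) → ℝ} (hu : ContDiff ℝ 2 u)
    (hp : ContDiff ℝ 3 p) (hc : HasCompactSupport p) (i j : Fin n) :
    ∫ x, lap u x * pd2 p i j x = ∫ x, pd2 u i j x * lap p x := by
  have hu1 : ∀ i j, Continuous (pd2 u i j) := fun i j => 
    (pd_contDiff (m := 0) (pd_contDiff (by simpa [one_add_one_eq_two] using hu) _) _).continuous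
  have hp1 : ∀ i j, Continuous (pd2 p i j) := fun i j => 
    (pd_contDiff (m := 0) (pd_contDiff (by simpa [one_add_one_eq_two] using hp.of_le (by norm_num)) _) _).continuous
  have hcc : ∀ i j, HasCompactSupport (pd2 p i j) := fun i j => pd_hcs (pd_hcs hc _) _
  unfold lap
  simp_rw [Finset.sum_mul, Finset.mul_sum]
  rw [integral_finsetSum, integral_finsetSum]
  · exact Finset.sum_congr rfl fun l _ => pd2_ibp hu hp hc i j l
  · intro l _
    exact ((hu1 _ _).mul (hp1 _ _)).integrable_of_hasCompactSupport (hcc _ _).mul_left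
  · intro l _
    exact ((hu1 _ _).mul (hp1 _ _)).integrable_of_hasCompactSupport (hcc _ _).mul_left

theorem lap_int_zero {n : ℕ} {p : EuclideanSpace ℝ (Fin n) → ℝ}
    (hp : ContDiff ℝ 2 p) (hc : HasCompactSupport p) : ∫ x, lap p x = 0 := by
  have hp0 : ∀ i, ContDiff ℝ 1 (pd p i) := fun i => pd_contDiff (by simpa [one_add_one_eq_two] using hp) i
  have hp1 : ∀ i j, Continuous (pd2 p i j) := fun i j => 
    (pd_contDiff (m := 0) (by simpa using hp0 j) i).continuous
  have hcc : ∀ i j, HasCompactSupport (pd2 p i j) := fun i j => pd_hcs (pd_hcs hc _) _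
  unfold lap
  rw [integral_finsetSum]
  · refine Finset.sum_eq_zero fun l _ => ?_
    have := pd_ibp (a := fun _ => (1:ℝ)) contDiff_const (hp0 l) (pd_hcs hc l) l
    simpa [pd2, pd] using this
  · intro l _
    exact (hp1 _ _).integrable_of_hasCompactSupport (hcc _ _)

theorem pd_radial {n : ℕ} {K k : ℝ → ℝ} (hK : ∀ s, HasDerivAt K (k s) s) (i : Fin n)
    (x : EuclideanSpace ℝ (Fin n)) :
    pd (fun x => K (‖x‖ ^ 2)) i x = 2 * x i * k (‖x‖ ^ 2) := by
  have h1 : HasFDerivAt (fun x : EuclideanSpace ℝ (Fin n) => ‖x‖ ^ 2) (2 • innerSL ℝ x) x :=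
    (hasStrictFDerivAt_norm_sq x).hasFDerivAt
  have h2 := (hK (‖x‖ ^ 2)).comp_hasFDerivAt x h1
  unfold pd
  rw [show (fun x : EuclideanSpace ℝ (Fin n) => K (‖x‖ ^ 2)) = K ∘ fun x => ‖x‖ ^ 2 from rfl, h2.fderiv]
  simp [EuclideanSpace.inner_single_right]
  ring

theorem pd2_radial {n : ℕ} {K k k' : ℝ → ℝ} (hK : ∀ s, HasDerivAt K (k s) s)
    (hk : ∀ s, HasDerivAt k (k' s) s) (i j : Fin n) (x : EuclideanSpace ℝ (Fin n)) :
    pd2 (fun x => K (‖x‖ ^ 2)) i j x =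
      (if i = j then 2 * k (‖x‖ ^ 2) else 0) + 4 * x i * x j * k' (‖x‖ ^ 2) := by
  have e : pd (fun x : EuclideanSpace ℝ (Fin n) => K (‖x‖ ^ 2)) j
      = fun x => (2 * x j) * k (‖x‖ ^ 2) := funext fun x => pd_radial hK j x
  have h1 : HasFDerivAt (fun x : EuclideanSpace ℝ (Fin n) => ‖x‖ ^ 2) (2 • innerSL ℝ x) x :=
    (hasStrictFDerivAt_norm_sq x).hasFDerivAt
  have h2 := (hk (‖x‖ ^ 2)).comp_hasFDerivAt x h1
  have h3 : HasFDerivAt (fun x : EuclideanSpace ℝ (Fin n) => 2 * x j)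
      ((2:ℝ) • (EuclideanSpace.proj j : EuclideanSpace ℝ (Fin n) →L[ℝ] ℝ)) x :=
    (EuclideanSpace.proj j : EuclideanSpace ℝ (Fin n) →L[ℝ] ℝ).hasFDerivAt.const_mul 2
  have h4 := h3.mul h2
  unfold pd2
  rw [e]
  unfold pd
  have := h4.fderiv
  simp only [Function.comp_def] at this
  erw [this]
  by_cases h : i = j
  · subst h
    simp [EuclideanSpace.inner_single_right]
    ring
  · simp [EuclideanSpace.inner_single_right, h, Ne.symm h, eq_comm]
    ring

theorem lap_radial {n : ℕ} {K k k' : ℝ → ℝ} (hK : ∀ s, HasDerivAt K (k s) s)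
    (hk : ∀ s, HasDerivAt k (k' s) s) (x : EuclideanSpace ℝ (Fin n)) :
    lap (fun x => K (‖x‖ ^ 2)) x = 2 * n * k (‖x‖ ^ 2) + 4 * ‖x‖ ^ 2 * k' (‖x‖ ^ 2) := by
  unfold lap
  simp_rw [pd2_radial hK hk]
  rw [Finset.sum_add_distrib]
  simp only [if_true, Finset.sum_const, Finset.card_univ, Fintype.card_fin, nsmul_eq_mul]
  rw [← Finset.sum_mul, EuclideanSpace.real_norm_sq_eq]
  simp_rw [mul_assoc]
  rw [← Finset.mul_sum]
  simp_rw [← pow_two]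
  ring

structure IsCut (θ : ℝ → ℝ) (M : ℝ) : Prop where
  smooth : ContDiff ℝ ∞ θ
  nonneg : ∀ s, 0 ≤ θ s
  one : ∀ s, |s| ≤ 1 → θ s = 1
  zero : ∀ s, 4 ≤ s → θ s = 0
  bound : ∀ s, |deriv θ s| ≤ M

theorem exists_cut : ∃ θ M, IsCut θ M := by
  let b : ContDiffBump (0:ℝ) := ⟨1, 4, by norm_num, by norm_num⟩
  have hs : ContDiff ℝ ∞ (b : ℝ → ℝ) := b.contDiff
  obtain ⟨M, hM⟩ := (b.hasCompactSupport.deriv).exists_bound_of_continuous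
    (hs.continuous_deriv (by simp))
  refine ⟨b, M, hs, fun s => b.nonneg, fun s h => b.one_of_mem_closedBall ?_, fun s h => b.zero_of_le_dist ?_, fun s => by simpa using hM s⟩
  · simpa [b] using h
  · simp only [b, dist_zero_right, Real.norm_eq_abs]
    exact h.trans (le_abs_self s)

theorem IsCut.deriv_lt {θ : ℝ → ℝ} {M : ℝ} (h : IsCut θ M) {s : ℝ} (hs : |s| < 1) : deriv θ s = 0 := by
  have : θ =ᶠ[𝓝 s] fun _ => 1 := by
    filter_upwards [(isOpen_lt continuous_abs continuous_const).mem_nhds hs] with t ht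
    exact h.one t (le_of_lt ht)
  rw [this.deriv_eq]; simp

theorem IsCut.deriv_gt {θ : ℝ → ℝ} {M : ℝ} (h : IsCut θ M) {s : ℝ} (hs : 4 < s) : deriv θ s = 0 := by
  have : θ =ᶠ[𝓝 s] fun _ => 0 := by
    filter_upwards [lt_mem_nhds hs] with t ht
    exact h.zero t (le_of_lt ht)
  rw [this.deriv_eq]; simp

noncomputable def gE (n : ℕ) (ε s : ℝ) : ℝ := (s ^ 2 + ε ^ 2) ^ (-(n : ℝ) / 4)
noncomputable def gE' (n : ℕ) (ε s : ℝ) : ℝ := -((n : ℝ) / 2) * s * (s ^ 2 + ε ^ 2) ^ (-(n : ℝ) / 4 - 1)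

theorem gE_pos {n : ℕ} {ε : ℝ} (hε : 0 < ε) (s : ℝ) : 0 < gE n ε s := by
  unfold gE; positivity

theorem gE_le {n : ℕ} {ε : ℝ} {s : ℝ} (hs : 1 ≤ s) : gE n ε s ≤ 1 := by
  unfold gE
  apply Real.rpow_le_one_of_one_le_of_nonpos
  · nlinarith [sq_nonneg ε]
  · have : (0:ℝ) ≤ n := by positivity
    linarith

theorem gE_smooth {n : ℕ} {ε : ℝ} (hε : 0 < ε) : ContDiff ℝ ∞ (gE n ε) := by
  unfold gE
  apply ContDiff.rpow_const_of_ne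
  · fun_prop
  · intro x; positivity

theorem gE_deriv {n : ℕ} {ε : ℝ} (hε : 0 < ε) (s : ℝ) : HasDerivAt (gE n ε) (gE' n ε s) s := by
  unfold gE gE'
  have h : HasDerivAt (fun s : ℝ => s ^ 2 + ε ^ 2) (2 * s) s := by
    simpa using (hasDerivAt_pow 2 s).add_const (ε ^ 2)
  have := h.rpow_const (p := -(n : ℝ) / 4) (Or.inl (by positivity))
  convert this using 1
  ring

theorem gE_rel {n : ℕ} {ε : ℝ} (hε : 0 < ε) (s : ℝ) :
    0 ≤ 2 * n * gE n ε s + 4 * s * gE' n ε s := by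
  have hp : 0 < s ^ 2 + ε ^ 2 := by positivity
  have : gE n ε s = (s ^ 2 + ε ^ 2) ^ (-(n : ℝ) / 4 - 1) * (s ^ 2 + ε ^ 2) := by
    unfold gE
    rw [← Real.rpow_add_one hp.ne']; congr 1; ring
  have e : 2 * n * gE n ε s + 4 * s * gE' n ε s
      = 2 * n * ε ^ 2 * (s ^ 2 + ε ^ 2) ^ (-(n : ℝ) / 4 - 1) := by
    rw [this]; unfold gE'; ring
  rw [e]; positivity

theorem exists_K {θ : ℝ → ℝ} {M : ℝ} (h : IsCut θ M) (n : ℕ) {ε : ℝ} (hε : 0 < ε) :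
    ∃ K : ℝ → ℝ, ContDiff ℝ ∞ K ∧ (∀ s, HasDerivAt K (θ s * gE n ε s) s) ∧
      (∀ s, 4 ≤ s → K s = 0) := by
  have hk : ContDiff ℝ ∞ (fun s => θ s * gE n ε s) := h.smooth.mul (gE_smooth hε)
  have hd : ∀ s, HasDerivAt (fun s => ∫ t in (4:ℝ)..s, θ t * gE n ε t) (θ s * gE n ε s) s :=
    fun s => intervalIntegral.integral_hasDerivAt_right (hk.continuous.intervalIntegrable _ _)
      (hk.continuous.stronglyMeasurableAtFilter _ _) hk.continuous.continuousAt
  refine ⟨fun s => ∫ t in (4:ℝ)..s, θ t * gE n ε t, ?_, hd, ?_⟩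
  · rw [contDiff_infty_iff_deriv]
    refine ⟨fun s => (hd s).differentiableAt, ?_⟩
    rwa [show deriv (fun s => ∫ t in (4:ℝ)..s, θ t * gE n ε t) = fun s => θ s * gE n ε s from
      funext fun s => (hd s).deriv]
  · intro s hs
    show ∫ t in (4:ℝ)..s, θ t * gE n ε t = 0
    rw [intervalIntegral.integral_congr (g := fun _ => (0:ℝ))]
    · simp
    · intro t ht
      rw [uIcc_of_le hs] at ht
      simp [h.zero t ht.1]

noncomputable def kE (θ : ℝ → ℝ) (n : ℕ) (ε s : ℝ) : ℝ := deriv θ s * gE n ε s + θ s * gE' n ε s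

theorem exists_psi {θ : ℝ → ℝ} {M : ℝ} (h : IsCut θ M) (n : ℕ) :
    ∃ C, ∀ ε : ℝ, 0 < ε → ∃ p : EuclideanSpace ℝ (Fin n) → ℝ, ContDiff ℝ 3 p ∧ HasCompactSupport p ∧
      (∀ x, 2 < ‖x‖ → lap p x = 0) ∧ (∫ x, |lap p x| ≤ C) ∧
      (∀ i j, i ≠ j → ∀ x, pd2 p i j x = 4 * x i * x j * kE θ n ε (‖x‖ ^ 2)) := by
  have hM : 0 ≤ M := (abs_nonneg _).trans (h.bound 0)
  let R : EuclideanSpace ℝ (Fin n) → ℝ := (Metric.closedBall 0 2).indicator fun _ => 16 * M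
  have hR : Integrable R := by
    apply IntegrableOn.integrable_indicator _ measurableSet_closedBall
    exact integrableOn_const (by exact measure_closedBall_lt_top.ne)
  refine ⟨2 * ∫ x, R x, fun ε hε => ?_⟩
  obtain ⟨K, hK, hK', hK0⟩ := exists_K h n hε
  have hk : ∀ s, HasDerivAt (fun s => θ s * gE n ε s) (kE θ n ε s) s := fun s =>
    ((h.smooth.differentiable (by simp) s).hasDerivAt).mul (gE_deriv hε s)
  have hp : ContDiff ℝ ∞ (fun x : EuclideanSpace ℝ (Fin n) => K (‖x‖ ^ 2)) :=
    hK.comp (contDiff_norm_sq ℝ)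
  have hc : HasCompactSupport (fun x : EuclideanSpace ℝ (Fin n) => K (‖x‖ ^ 2)) := by
    apply HasCompactSupport.intro (isCompact_closedBall (0 : EuclideanSpace ℝ (Fin n)) 2)
    intro x hx
    simp only [Metric.mem_closedBall, dist_zero_right, not_le] at hx
    exact hK0 _ (by nlinarith)
  have hp2 : ContDiff ℝ 2 (fun x : EuclideanSpace ℝ (Fin n) => K (‖x‖ ^ 2)) := by
    exact_mod_cast contDiff_infty.1 hp 2
  have hl := lap_radial (n := n) hK' hk
  have hz : ∀ x : EuclideanSpace ℝ (Fin n), 2 < ‖x‖ → lap (fun x => K (‖x‖ ^ 2)) x = 0 := by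
    intro x hx
    have : 4 < ‖x‖ ^ 2 := by nlinarith
    rw [hl, kE, h.zero _ this.le, h.deriv_gt this]; simp
  have hcont : Continuous (lap (fun x : EuclideanSpace ℝ (Fin n) => K (‖x‖ ^ 2))) := by
    unfold lap
    refine continuous_finsetSum _ fun i _ => ?_
    exact (pd_contDiff (m := 0) (pd_contDiff (by simpa [one_add_one_eq_two] using hp2) _) _).continuous
  have hlc : HasCompactSupport (lap (fun x : EuclideanSpace ℝ (Fin n) => K (‖x‖ ^ 2))) := by
    apply HasCompactSupport.intro (isCompact_closedBall (0 : EuclideanSpace ℝ (Fin n)) 2)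
    intro x hx
    simp only [Metric.mem_closedBall, dist_zero_right, not_le] at hx
    exact hz x hx
  have hint := hcont.integrable_of_hasCompactSupport hlc (μ := volume)
  refine ⟨_, by exact_mod_cast contDiff_infty.1 hp 3, hc, hz, ?_, ?_⟩
  · have key : ∀ x : EuclideanSpace ℝ (Fin n), |lap (fun x => K (‖x‖ ^ 2)) x| ≤
        lap (fun x => K (‖x‖ ^ 2)) x + 2 * R x := by
      intro x
      by_cases hx : 2 < ‖x‖
      · have : R x = 0 := by simp [R, hx]
        rw [hz x hx, this]; simp
      · have hRx : R x = 16 * M := by simp [R, not_lt.1 hx]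
        have hs0 : 0 ≤ ‖x‖ ^ 2 := by positivity
        have hs4 : ‖x‖ ^ 2 ≤ 4 := by nlinarith [norm_nonneg x]
        rw [hl, hRx]
        generalize ‖x‖ ^ 2 = s at *
        have e : 2 * n * (θ s * gE n ε s) + 4 * s * kE θ n ε s
          = θ s * (2 * n * gE n ε s + 4 * s * gE' n ε s) + 4 * s * (deriv θ s * gE n ε s) := by
          unfold kE; ring
        have h1 := mul_nonneg (h.nonneg s) (gE_rel (n := n) hε s)
        have h2 : |4 * s * (deriv θ s * gE n ε s)| ≤ 16 * M := by
          by_cases hs : s < 1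
          · rw [h.deriv_lt (by rwa [abs_of_nonneg hs0])]; simpa using hM
          · rw [abs_mul, abs_mul (deriv θ s), abs_of_nonneg (by positivity : 0 ≤ 4 * s), abs_of_pos (gE_pos hε s)]
            have a := gE_le (n := n) (ε := ε) (not_lt.1 hs)
            have : |deriv θ s| * gE n ε s ≤ M * 1 := by
              gcongr
              · exact (gE_pos hε s).le
              · exact h.bound s
            calc 4 * s * (|deriv θ s| * gE n ε s) ≤ (4 * 4) * (M * 1) := by
                  gcongr
                  exact mul_nonneg (abs_nonneg _) (gE_pos hε s).le
              _ = _ := by ring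
        rw [e]
        rw [abs_le] at h2 ⊢
        constructor <;> linarith
    calc _ ≤ ∫ x : EuclideanSpace ℝ (Fin n), (lap (fun x => K (‖x‖ ^ 2)) x + 2 * R x) :=
          integral_mono hint.abs (hint.add (hR.const_mul 2)) key
      _ = _ := by
          rw [integral_add hint (hR.const_mul 2), lap_int_zero hp2 hc, integral_const_mul]; simp
  · intro i j hij x
    rw [pd2_radial hK' hk]; simp [hij]

noncomputable def WE {n : ℕ} (i j : Fin n) (ε : ℝ) (x : EuclideanSpace ℝ (Fin n)) : ℝ :=
  2 * n * ((x i * x j) ^ 2 / (‖x‖ ^ 2 + ε)) *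
    (‖x‖ ^ 2 * ((‖x‖ ^ 2) ^ 2 + ε ^ 2) ^ (-(n : ℝ) / 4 - 1))

theorem WE_nonneg {n : ℕ} (i j : Fin n) {ε : ℝ} (hε : 0 ≤ ε) (x : EuclideanSpace ℝ (Fin n)) :
    0 ≤ WE i j ε x := by
  unfold WE; positivity

theorem WE_measurable {n : ℕ} (i j : Fin n) (ε : ℝ) : Measurable (WE (n := n) i j ε) := by
  unfold WE; fun_prop

theorem WE_continuous {n : ℕ} (i j : Fin n) {ε : ℝ} (hε : 0 < ε) : Continuous (WE (n := n) i j ε) := by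
  unfold WE
  refine (continuous_const.mul (Continuous.div (by fun_prop) (by fun_prop) fun x => by positivity)).mul
    (Continuous.mul (by fun_prop) (Continuous.rpow_const (by fun_prop) fun x => Or.inl (by positivity)))

theorem WE_tendsto {n : ℕ} (i j : Fin n) {e : ℕ → ℝ} (he : Tendsto e atTop (𝓝 0))
    (x : EuclideanSpace ℝ (Fin n)) : Tendsto (fun k => WE i j (e k) x) atTop (𝓝 (WE i j 0 x)) := by
  by_cases hx : x = 0
  · subst hx; simp [WE]
  have hx' : 0 < ‖x‖ := norm_pos_iff.2 hx
  have : ContinuousAt (fun ε => WE i j ε x) 0 := by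
    unfold WE
    refine (continuousAt_const.mul (ContinuousAt.div (by fun_prop) (by fun_prop) (by positivity))).mul
      (continuousAt_const.mul (ContinuousAt.rpow_const (by fun_prop) (Or.inl (by positivity))))
  exact this.tendsto.comp he

theorem WE_homog {n : ℕ} (i j : Fin n) (x : EuclideanSpace ℝ (Fin n)) :
    WE i j 0 ((2:ℝ) • x) = ((2:ℝ) ^ n)⁻¹ * WE i j 0 x := by
  by_cases hx : x = 0
  · subst hx; simp [WE]
  have hx' : 0 < ‖x‖ := norm_pos_iff.2 hx
  unfold WE
  have e1 : ((2:ℝ) ^ 4) ^ (-(n : ℝ) / 4 - 1) = ((2:ℝ) ^ n)⁻¹ * (2 ^ 4)⁻¹ := by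
    rw [← Real.rpow_natCast 2 4, ← Real.rpow_mul (by norm_num), ← Real.rpow_natCast 2 n,
      ← Real.rpow_neg (by norm_num), ← Real.rpow_neg (by norm_num), ← Real.rpow_add (by norm_num)]
    congr 1; push_cast; ring
  simp only [norm_smul, PiLp.smul_apply, smul_eq_mul, Real.norm_ofNat]
  rw [show ((2 * ‖x‖) ^ 2) ^ 2 + (0:ℝ) ^ 2 = 2 ^ 4 * ((‖x‖ ^ 2) ^ 2 + 0 ^ 2) by ring,
    Real.mul_rpow (by positivity) (by positivity), e1]
  field_simp
  ring

theorem WE_not_int {n : ℕ} (i j : Fin n) (hij : i ≠ j) :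
    ¬ IntegrableOn (WE i j 0) (Metric.ball (0 : EuclideanSpace ℝ (Fin n)) 1) := by
  intro h
  have hn : 0 < n := Fin.pos i
  have h1 := Measure.setIntegral_comp_smul_of_pos volume (WE i j 0)
    (Metric.ball (0 : EuclideanSpace ℝ (Fin n)) (1/2)) (R := 2) (by norm_num)
  simp_rw [WE_homog] at h1
  rw [integral_const_mul, smul_ball (by norm_num)] at h1
  simp only [finrank_euclideanSpace, Fintype.card_fin, smul_eq_mul, smul_zero, Real.norm_ofNat] at h1
  have h2 := mul_left_cancel₀ (by positivity) h1
  rw [show (2:ℝ) * (1/2) = 1 by norm_num] at h2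
  have hsub : Metric.ball (0 : EuclideanSpace ℝ (Fin n)) (1/2) ⊆ Metric.ball 0 1 :=
    Metric.ball_subset_ball (by norm_num)
  have h3 := setIntegral_sdiff measurableSet_ball h hsub
  rw [h2, sub_self] at h3
  have h4 := (setIntegral_pos_iff_support_of_nonneg_ae (μ := volume)
    (s := Metric.ball (0 : EuclideanSpace ℝ (Fin n)) 1 \ Metric.ball 0 (1/2))
    (Eventually.of_forall fun x => WE_nonneg i j le_rfl x) (h.mono_set sdiff_subset)).2 ?_
  · linarith
  let U : Set (EuclideanSpace ℝ (Fin n)) := {x | 1/2 < ‖x‖ ∧ ‖x‖ < 1 ∧ x i ≠ 0 ∧ x j ≠ 0}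
  have hU : IsOpen U := by
    refine (isOpen_lt continuous_const continuous_norm).inter
      ((isOpen_lt continuous_norm continuous_const).inter ((isOpen_ne_fun (by fun_prop) (by fun_prop)).inter 
        (isOpen_ne_fun (by fun_prop) (by fun_prop))))
  have hne : U.Nonempty := by
    refine ⟨EuclideanSpace.single i (3/5) + EuclideanSpace.single j (3/5), ?_⟩
    have hin : ‖(EuclideanSpace.single i (3/5) + EuclideanSpace.single j (3/5) : EuclideanSpace ℝ (Fin n))‖ ^ 2
        = 18/25 := by
      rw [norm_add_sq_real]
      simp [EuclideanSpace.inner_single_right, hij, hij.symm]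
      norm_num
    refine ⟨?_, ?_, ?_, ?_⟩
    · nlinarith [norm_nonneg (EuclideanSpace.single i (3/5) + EuclideanSpace.single j (3/5) : EuclideanSpace ℝ (Fin n))]
    · nlinarith [norm_nonneg (EuclideanSpace.single i (3/5) + EuclideanSpace.single j (3/5) : EuclideanSpace ℝ (Fin n))]
    · simp [hij, hij.symm]
    · simp [hij, hij.symm]
  refine (hU.measure_pos volume hne).trans_le (measure_mono ?_)
  rintro x ⟨ha, hb, hc, hd⟩
  have hx : 0 < ‖x‖ := by linarith
  refine ⟨?_, by simpa using hb, by simpa using ha.le⟩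
  rw [Function.mem_support]
  unfold WE
  have : (n:ℝ) ≠ 0 := by positivity
  positivity

theorem WE_fatou {n : ℕ} (i j : Fin n) {e : ℕ → ℝ} (he : Tendsto e atTop (𝓝 0)) (hpos : ∀ k, 0 < e k)
    (D : ℝ) (hD : ∀ k, ∫ x in Metric.ball (0 : EuclideanSpace ℝ (Fin n)) 1, WE i j (e k) x ≤ D) :
    IntegrableOn (WE i j 0) (Metric.ball (0 : EuclideanSpace ℝ (Fin n)) 1) := by
  refine ⟨(WE_measurable i j 0).aestronglyMeasurable, ?_⟩
  rw [hasFiniteIntegral_iff_ofReal (Eventually.of_forall fun x => WE_nonneg i j le_rfl x)]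
  have hint : ∀ k, IntegrableOn (WE i j (e k)) (Metric.ball (0 : EuclideanSpace ℝ (Fin n)) 1) := fun k =>
    ((WE_continuous i j (hpos k)).continuousOn.integrableOn_compact
      (isCompact_closedBall (0 : EuclideanSpace ℝ (Fin n)) 1)).mono_set Metric.ball_subset_closedBall
  calc _ = ∫⁻ x in Metric.ball (0 : EuclideanSpace ℝ (Fin n)) 1,
        liminf (fun k => ENNReal.ofReal (WE i j (e k) x)) atTop := by
        refine lintegral_congr fun x => ?_
        exact ((ENNReal.continuous_ofReal.tendsto _).comp (WE_tendsto i j he x)).liminf_eq.symm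
    _ ≤ liminf (fun k => ∫⁻ x in Metric.ball (0 : EuclideanSpace ℝ (Fin n)) 1,
        ENNReal.ofReal (WE i j (e k) x)) atTop :=
        lintegral_liminf_le fun k => (WE_measurable i j (e k)).ennreal_ofReal
    _ ≤ ENNReal.ofReal D := by
        refine liminf_le_of_le (by isBoundedDefault) fun b hb => ?_
        obtain ⟨k, hk⟩ := hb.exists
        refine hk.trans ?_
        rw [← ofReal_integral_eq_lintegral_ofReal (hint k)
          (Eventually.of_forall fun x => WE_nonneg i j (hpos k).le x)]
        exact ENNReal.ofReal_le_ofReal (hD k)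
    _ < ⊤ := ENNReal.ofReal_lt_top

theorem IsCut.dg_bound {θ : ℝ → ℝ} {M : ℝ} (h : IsCut θ M) (n : ℕ) {ε : ℝ} (hε : 0 < ε) {s : ℝ}
    (hs0 : 0 ≤ s) : |deriv θ s * gE n ε s| ≤ M := by
  have hM : 0 ≤ M := (abs_nonneg _).trans (h.bound 0)
  by_cases hs : s < 1
  · rw [h.deriv_lt (by rwa [abs_of_nonneg hs0])]; simpa using hM
  · rw [abs_mul, abs_of_pos (gE_pos hε s)]
    have a := gE_le (n := n) (ε := ε) (not_lt.1 hs)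
    calc |deriv θ s| * gE n ε s ≤ M * 1 :=
          mul_le_mul (h.bound s) a (gE_pos hε s).le hM
      _ = M := mul_one M

theorem coord_sq_le {n : ℕ} (i j : Fin n) (x : EuclideanSpace ℝ (Fin n)) :
    |x i * x j| ≤ ‖x‖ ^ 2 := by
  rw [abs_mul, pow_two]
  exact mul_le_mul (PiLp.norm_apply_le x i) (PiLp.norm_apply_le x j) (abs_nonneg _) (norm_nonneg _)

theorem WE_pointwise {θ : ℝ → ℝ} {M : ℝ} (h : IsCut θ M) {n : ℕ} (i j : Fin n) {ε : ℝ} (hε : 0 < ε)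
    (x : EuclideanSpace ℝ (Fin n)) :
    (Metric.ball (0 : EuclideanSpace ℝ (Fin n)) 1).indicator (WE i j ε) x ≤
      - (x i * x j / (‖x‖ ^ 2 + ε) * (4 * x i * x j * kE θ n ε (‖x‖ ^ 2))) +
      (Metric.closedBall (0 : EuclideanSpace ℝ (Fin n)) 2).indicator (fun _ => 16 * M) x := by
  have hM : 0 ≤ M := (abs_nonneg _).trans (h.bound 0)
  have hs0 : 0 ≤ ‖x‖ ^ 2 := by positivity
  have e : - (x i * x j / (‖x‖ ^ 2 + ε) * (4 * x i * x j * kE θ n ε (‖x‖ ^ 2))) =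
      θ (‖x‖ ^ 2) * WE i j ε x - 4 * ((x i * x j) ^ 2 / (‖x‖ ^ 2 + ε)) *
        (deriv θ (‖x‖ ^ 2) * gE n ε (‖x‖ ^ 2)) := by
    unfold WE kE gE'
    field_simp
    ring
  rw [e]
  have h1 : (Metric.ball (0 : EuclideanSpace ℝ (Fin n)) 1).indicator (WE i j ε) x ≤
      θ (‖x‖ ^ 2) * WE i j ε x := by
    by_cases hx : x ∈ Metric.ball (0 : EuclideanSpace ℝ (Fin n)) 1
    · rw [indicator_of_mem hx, h.one, one_mul]
      rw [mem_ball_zero_iff] at hx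
      rw [abs_of_nonneg hs0]
      nlinarith [norm_nonneg x]
    · rw [indicator_of_notMem hx]
      exact mul_nonneg (h.nonneg _) (WE_nonneg i j hε.le x)
  have h2 : 4 * ((x i * x j) ^ 2 / (‖x‖ ^ 2 + ε)) * (deriv θ (‖x‖ ^ 2) * gE n ε (‖x‖ ^ 2)) ≤
      (Metric.closedBall (0 : EuclideanSpace ℝ (Fin n)) 2).indicator (fun _ => 16 * M) x := by
    by_cases hx : x ∈ Metric.closedBall (0 : EuclideanSpace ℝ (Fin n)) 2
    · rw [indicator_of_mem hx]
      rw [mem_closedBall_zero_iff] at hx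
      have hs4 : ‖x‖ ^ 2 ≤ 4 := by nlinarith [norm_nonneg x]
      have a1 : (x i * x j) ^ 2 / (‖x‖ ^ 2 + ε) ≤ 4 := by
        rw [div_le_iff₀ (by positivity)]
        have := coord_sq_le i j x
        rw [← sq_abs]
        nlinarith [abs_nonneg (x i * x j)]
      have a2 := (le_abs_self _).trans (h.dg_bound n hε hs0)
      have a3 : 0 ≤ (x i * x j) ^ 2 / (‖x‖ ^ 2 + ε) := by positivity
      calc _ ≤ 4 * ((x i * x j) ^ 2 / (‖x‖ ^ 2 + ε)) * M := by gcongr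
        _ ≤ 4 * 4 * M := by gcongr
        _ = _ := by ring
    · rw [indicator_of_notMem hx]
      rw [mem_closedBall_zero_iff, not_le] at hx
      rw [h.deriv_gt (by nlinarith)]; simp
  linarith

theorem no_sol {n : ℕ} (i j : Fin n) (hij : i ≠ j)
    (H : ∀ f : EuclideanSpace ℝ (Fin n) → ℝ, Continuous f → HasCompactSupport f →
      ∃ u : EuclideanSpace ℝ (Fin n) → ℝ, ContDiff ℝ 2 u ∧ ∀ x, lap u x = f x) : False := by
  obtain ⟨θ, M, h⟩ := exists_cut
  obtain ⟨C, hC⟩ := exists_psi h n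
  let e : ℕ → ℝ := fun k => 1 / ((k : ℝ) + 1)
  have he : Tendsto e atTop (𝓝 0) := tendsto_one_div_add_atTop_nhds_zero_nat
  have hpos : ∀ k, 0 < e k := fun k => by simp only [e]; positivity
  choose p hp3 hpc hplap hpC hpij using fun k => hC (e k) (hpos k)
  let q : ℕ → EuclideanSpace ℝ (Fin n) → ℝ := fun k => pd2 (p k) i j
  have hqc : ∀ k, Continuous (q k) := fun k =>
    (pd_contDiff (m := 0) (pd_contDiff (by
      simpa [one_add_one_eq_two] using (hp3 k).of_le (by norm_num)) _) _).continuous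
  have hlc : ∀ k, Continuous (lap (p k)) := fun k => by
    unfold lap
    refine continuous_finsetSum _ fun i _ => ?_
    exact (pd_contDiff (m := 0) (pd_contDiff (by
      simpa [one_add_one_eq_two] using (hp3 k).of_le (by norm_num)) _) _).continuous
  have hqs : ∀ k, HasCompactSupport (q k) := fun k => pd_hcs (pd_hcs (hpc k) _) _
  have hls : ∀ k, HasCompactSupport (lap (p k)) := fun k => by
    apply HasCompactSupport.intro (isCompact_closedBall (0 : EuclideanSpace ℝ (Fin n)) 2)
    intro x hx
    rw [mem_closedBall_zero_iff, not_le] at hx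
    exact hplap k x hx
  have hq0 : ∀ k x, 2 < ‖x‖ → q k x = 0 := fun k x hx => by
    have : 4 < ‖x‖ ^ 2 := by nlinarith
    simp only [q]
    rw [hpij k i j hij, kE, h.zero _ this.le, h.deriv_gt this]; simp
  have hint : ∀ k (g : BoundedContinuousFunction (EuclideanSpace ℝ (Fin n)) ℝ),
      Integrable (fun x => g x * q k x) := fun k g =>
    (g.continuous.mul (hqc k)).integrable_of_hasCompactSupport (hqs k).mul_left
  let T : ℕ → (BoundedContinuousFunction (EuclideanSpace ℝ (Fin n)) ℝ) →L[ℝ] ℝ := fun k =>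
    LinearMap.mkContinuous
      { toFun := fun g => ∫ x, g x * q k x
        map_add' := fun g₁ g₂ => by
          rw [← integral_add (hint k g₁) (hint k g₂)]
          simp [add_mul]
        map_smul' := fun c g => by
          rw [RingHom.id_apply, smul_eq_mul, ← integral_const_mul]
          simp [mul_assoc] } (∫ x, |q k x|) (fun g => by
        have hqi : Integrable (q k) := (hqc k).integrable_of_hasCompactSupport (hqs k)
        rw [mul_comm, ← integral_const_mul]
        refine norm_integral_le_of_norm_le (hqi.abs.const_mul _) (Eventually.of_forall fun x => ?_)
        rw [norm_mul]
        exact mul_le_mul_of_nonneg_right (g.norm_coe_le_norm x) (norm_nonneg _))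
  have hT : ∀ k g, T k g = ∫ x, g x * q k x := fun k g => rfl
  obtain ⟨C', hC'⟩ := banach_steinhaus (g := T) (by
    intro g
    let b : ContDiffBump (0 : EuclideanSpace ℝ (Fin n)) := ⟨2, 3, by norm_num, by norm_num⟩
    obtain ⟨u, hu, hul⟩ := H (fun x => b x * g x) (b.continuous.mul g.continuous)
      b.hasCompactSupport.mul_right
    have huc : Continuous (pd2 u i j) :=
      (pd_contDiff (m := 0) (pd_contDiff (by
        simpa [one_add_one_eq_two] using hu) _) _).continuous
    obtain ⟨B, hB⟩ := (isCompact_closedBall (0 : EuclideanSpace ℝ (Fin n)) 2).exists_bound_of_continuousOn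
      huc.continuousOn
    have hB0 : 0 ≤ B := (norm_nonneg _).trans (hB 0 (by simp))
    refine ⟨B * C, fun k => ?_⟩
    have e1 : T k g = ∫ x, pd2 u i j x * lap (p k) x := by
      rw [hT, ← lap_ibp hu (hp3 k) (hpc k)]
      refine integral_congr_ae (Eventually.of_forall fun x => ?_)
      by_cases hx : 2 < ‖x‖
      · have := hq0 k x hx
        simp only [q] at this ⊢
        simp [this]
      · have : b x = 1 := b.one_of_mem_closedBall (by simpa [b] using hx)
        simp [hul, this, q]
    have hli : Integrable (lap (p k)) := (hlc k).integrable_of_hasCompactSupport (hls k)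
    rw [e1]
    calc _ ≤ ∫ x, B * |lap (p k) x| := by
          refine norm_integral_le_of_norm_le (hli.abs.const_mul _) (Eventually.of_forall fun x => ?_)
          rw [norm_mul]
          by_cases hx : 2 < ‖x‖
          · simp [hplap k x hx]
          · exact mul_le_mul_of_nonneg_right (hB x (by simpa using hx)) (norm_nonneg _)
      _ ≤ B * C := by
          rw [integral_const_mul]
          exact mul_le_mul_of_nonneg_left (hpC k) hB0)
  let R : EuclideanSpace ℝ (Fin n) → ℝ := (Metric.closedBall 0 2).indicator fun _ => 16 * M
  have hR : Integrable R := by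
    apply IntegrableOn.integrable_indicator _ measurableSet_closedBall
    exact integrableOn_const (by exact measure_closedBall_lt_top.ne)
  refine WE_not_int i j hij (WE_fatou i j he hpos (C' + ∫ x, R x) fun k => ?_)
  have hek := hpos k
  let g : BoundedContinuousFunction (EuclideanSpace ℝ (Fin n)) ℝ :=
    BoundedContinuousFunction.ofNormedAddCommGroup (fun x => x i * x j / (‖x‖ ^ 2 + e k))
      (Continuous.div (by fun_prop) (by fun_prop) fun x => by positivity) 1 (fun x => by
        rw [Real.norm_eq_abs, abs_div, abs_of_pos (by positivity : 0 < ‖x‖ ^ 2 + e k),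
          div_le_one (by positivity)]
        linarith [coord_sq_le i j x])
  have hg : ‖g‖ ≤ 1 := BoundedContinuousFunction.norm_ofNormedAddCommGroup_le _ zero_le_one _
  have hgx : ∀ x, g x = x i * x j / (‖x‖ ^ 2 + e k) := fun x => rfl
  have hTg : |T k g| ≤ C' := by
    calc |T k g| ≤ ‖T k‖ * ‖g‖ := (T k).le_opNorm g
      _ ≤ ‖T k‖ * 1 := by gcongr
      _ ≤ C' := by simpa using hC' k
  have hWi : IntegrableOn (WE i j (e k)) (Metric.ball (0 : EuclideanSpace ℝ (Fin n)) 1) :=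
    ((WE_continuous i j (hpos k)).continuousOn.integrableOn_compact
      (isCompact_closedBall (0 : EuclideanSpace ℝ (Fin n)) 1)).mono_set Metric.ball_subset_closedBall
  rw [← integral_indicator measurableSet_ball]
  calc _ ≤ ∫ x, (-(g x * q k x) + R x) := by
        refine integral_mono (hWi.integrable_indicator measurableSet_ball) ((hint k g).neg.add hR) fun x => ?_
        have := WE_pointwise h i j hek x
        rw [← hpij k i j hij, ← hgx] at this
        exact this
    _ = - T k g + ∫ x, R x := by
        rw [hT, ← integral_neg]
        exact integral_add (hint k g).neg hR
    _ ≤ _ := by linarith [neg_abs_le (T k g)]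

/-- For `n ≥ 2` there is a continuous compactly supported `f : ℝⁿ → ℝ` such that
the Poisson equation `Δu = f` has no `C²` solution on `ℝⁿ`. -/
theorem exists_continuous_rhs_no_C2_solution (n : ℕ) (hn : 2 ≤ n) :
    ∃ f : EuclideanSpace ℝ (Fin n) → ℝ, Continuous f ∧ HasCompactSupport f ∧
      ¬ ∃ u : EuclideanSpace ℝ (Fin n) → ℝ, ContDiff ℝ 2 u ∧ ∀ x, lap u x = f x := by
  by_contra hcon
  push Not at hcon
  refine no_sol (n := n) ⟨0, by omega⟩ ⟨1, by omega⟩ (by simp) fun f hf hc => ?_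
  by_contra hu
  push Not at hu
  obtain ⟨u, hu1, hu2⟩ := hcon f hf hc
  obtain ⟨x, hx⟩ := hu u hu1
  exact hx (hu2 x)
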